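/- arXiv:2012.07067 — 3 statements merged into one kernel-verified Lean document; each statement's English description precedes it below -/
import Mathlib

section
/- Let p be a prime, n ≥ 1, and let k = (k_1, …, k_d) be an index. Then, for both • = (non-star) and • = ⋆, the rational number H•_{p−1}(k) − (−1)^{wt(k)} · Σ_{l ∈ ℤ_{≥0}^d, wt(l) < n} p^{wt(l)} · b(k; l) · H•_{p−1}(rev(k + l)) lies in p^n ℤ_{(p)}, where the sum is over all d-tuples l of non-negative integers with l_1 + ⋯ + l_d ≤ n − 1. -/
open Finset

/-- Multiple harmonic sum `H_m(k)` (`star = false`: strict inequalities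
`m ≥ m₁ > ⋯ > m_d > 0`; `star = true`: weak inequalities). -/
noncomputable def MHS (star : Bool) : ℕ → List ℕ → ℚ
  | _, [] => 1
  | m, k :: ks => ∑ i ∈ Finset.Icc 1 m,
      (1 / (i : ℚ) ^ k) * MHS star (if star then i else i - 1) ks

/-- `q ∈ p^n ℤ_(p)`. -/
def DD (p n : ℕ) (q : ℚ) : Prop := ∃ a b : ℤ, ¬ ((p : ℤ) ∣ b) ∧ q * b = p ^ n * a

theorem DD.mul {p : ℕ} (hp : p.Prime) {m n : ℕ} {q r : ℚ} (h : DD p m q) (h' : DD p n r) :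
    DD p (m + n) (q * r) := by
  obtain ⟨a, b, hb, e⟩ := h
  obtain ⟨a', b', hb', e'⟩ := h'
  refine ⟨a * a', b * b', ?_, ?_⟩
  · intro hd
    rcases (Nat.prime_iff_prime_int.mp hp).dvd_or_dvd hd with h | h
    · exact hb h
    · exact hb' h
  · push_cast
    calc q * r * (b * b') = (q * b) * (r * b') := by ring
      _ = _ := by rw [e, e']; ring

theorem DD.add {p : ℕ} (hp : p.Prime) {n : ℕ} {q r : ℚ} (h : DD p n q) (h' : DD p n r) :
    DD p n (q + r) := by
  obtain ⟨a, b, hb, e⟩ := h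
  obtain ⟨a', b', hb', e'⟩ := h'
  refine ⟨a * b' + a' * b, b * b', ?_, ?_⟩
  · intro hd
    rcases (Nat.prime_iff_prime_int.mp hp).dvd_or_dvd hd with h | h
    · exact hb h
    · exact hb' h
  · push_cast
    calc (q + r) * (b * b') = (q * b) * b' + (r * b') * b := by ring
      _ = _ := by rw [e, e']; ring

theorem DD.int {p : ℕ} (hp : p.Prime) (z : ℤ) : DD p 0 (z : ℚ) :=
  ⟨z, 1, fun h => (Nat.prime_iff_prime_int.mp hp).not_isUnit (isUnit_of_dvd_one h), by simp⟩

theorem DD.zero {p : ℕ} (hp : p.Prime) (n : ℕ) : DD p n 0 :=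
  ⟨0, 1, fun h => (Nat.prime_iff_prime_int.mp hp).not_isUnit (isUnit_of_dvd_one h), by simp⟩

theorem DD.one {p : ℕ} (hp : p.Prime) : DD p 0 1 := by simpa using DD.int hp 1

theorem DD.mulr {p : ℕ} (hp : p.Prime) {n : ℕ} {q r : ℚ} (h : DD p 0 q) (h' : DD p n r) :
    DD p n (q * r) := by simpa using h.mul hp h'

theorem DD.neg {p : ℕ} (hp : p.Prime) {n : ℕ} {q : ℚ} (h : DD p n q) : DD p n (-q) := by
  have := (DD.int hp (-1)).mulr hp h
  simpa using this

theorem DD.sub {p : ℕ} (hp : p.Prime) {n : ℕ} {q r : ℚ} (h : DD p n q) (h' : DD p n r) :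
    DD p n (q - r) := by
  rw [sub_eq_add_neg]; exact h.add hp (h'.neg hp)

theorem DD.sum {p : ℕ} (hp : p.Prime) {n : ℕ} {ι : Type*} (s : Finset ι) (f : ι → ℚ)
    (h : ∀ i ∈ s, DD p n (f i)) : DD p n (∑ i ∈ s, f i) :=
  Finset.sum_induction f (DD p n) (fun _ _ a b => a.add hp b) (DD.zero hp n) h

theorem DD.prod {p : ℕ} (hp : p.Prime) {ι : Type*} (s : Finset ι) (f : ι → ℚ)
    (h : ∀ i ∈ s, DD p 0 (f i)) : DD p 0 (∏ i ∈ s, f i) :=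
  Finset.prod_induction f (DD p 0) (fun _ _ a b => a.mulr hp b) (DD.one hp) h

theorem DD.pow {p : ℕ} (hp : p.Prime) {q : ℚ} (h : DD p 0 q) (n : ℕ) : DD p 0 (q ^ n) := by
  induction n with
  | zero => simpa using DD.one hp
  | succ n ih => rw [pow_succ]; exact ih.mulr hp h

theorem DD.ppow {p : ℕ} (hp : p.Prime) (n : ℕ) : DD p n ((p : ℚ) ^ n) :=
  ⟨1, 1, fun h => (Nat.prime_iff_prime_int.mp hp).not_isUnit (isUnit_of_dvd_one h), by simp⟩

theorem DD.mono {p : ℕ} {m n : ℕ} (hmn : n ≤ m) {q : ℚ} (h : DD p m q) : DD p n q := by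
  obtain ⟨a, b, hb, e⟩ := h
  refine ⟨p ^ (m - n) * a, b, hb, ?_⟩
  rw [e]; push_cast
  rw [← mul_assoc, ← pow_add, Nat.add_sub_cancel' hmn]

theorem DD.inv {p : ℕ} {i : ℕ} (h1 : 1 ≤ i) (h2 : i < p) : DD p 0 (1 / (i : ℚ)) := by
  refine ⟨1, i, ?_, ?_⟩
  · intro h
    have := Nat.le_of_dvd h1 (Int.natCast_dvd_natCast.mp h)
    omega
  · have : (i : ℚ) ≠ 0 := by positivity
    push_cast; field_simp

theorem DD.prod_sub {p : ℕ} (hp : p.Prime) {n : ℕ} {ι : Type*} (s : Finset ι) (f g : ι → ℚ)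
    (hf : ∀ i ∈ s, DD p 0 (f i)) (hg : ∀ i ∈ s, DD p 0 (g i))
    (h : ∀ i ∈ s, DD p n (f i - g i)) : DD p n (∏ i ∈ s, f i - ∏ i ∈ s, g i) := by
  classical
  induction s using Finset.induction_on with
  | empty => simpa using DD.zero hp n
  | insert a s ha ih =>
    rw [Finset.prod_insert ha, Finset.prod_insert ha]
    have e : f a * ∏ i ∈ s, f i - g a * ∏ i ∈ s, g i
      = f a * (∏ i ∈ s, f i - ∏ i ∈ s, g i) + (∏ i ∈ s, g i) * (f a - g a) := by ring
    rw [e]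
    refine DD.add hp (DD.mulr hp (hf a (by simp)) (ih ?_ ?_ ?_)) (DD.mulr hp (DD.prod hp _ _ ?_) (h a (by simp)))
    · exact fun i hi => hf i (by simp [hi])
    · exact fun i hi => hg i (by simp [hi])
    · exact fun i hi => h i (by simp [hi])
    · exact fun i hi => hg i (by simp [hi])

theorem series_step (k n : ℕ) (y : ℚ) :
    (1 - y) * ∑ l ∈ range (n + 1), ((k + 1 + l - 1).choose l : ℚ) * y ^ l
      = ∑ l ∈ range (n + 1), ((k + l - 1).choose l : ℚ) * y ^ l
        - ((k + n).choose n : ℚ) * y ^ (n + 1) := by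
  induction n with
  | zero => simp
  | succ n ih =>
    rw [sum_range_succ, mul_add, ih, sum_range_succ _ (n + 1)]
    have e1 : k + 1 + (n + 1) - 1 = (k + n) + 1 := by omega
    have e2 : k + (n + 1) - 1 = k + n := by omega
    have e3 : k + (n + 1) = (k + n) + 1 := by omega
    rw [e1, e2, e3, Nat.choose_succ_succ]
    push_cast
    ring

theorem series_mod {p : ℕ} (hp : p.Prime) (n k : ℕ) (y w : ℚ) (hy : DD p (n + 1) (y ^ (n + 1)))
    (hw : DD p 0 w) (hyw : w * (1 - y) = 1) :
    DD p (n + 1) (w ^ k - ∑ l ∈ range (n + 1), ((k + l - 1).choose l : ℚ) * y ^ l) := by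
  induction k with
  | zero =>
    have : ∑ l ∈ range (n + 1), ((0 + l - 1).choose l : ℚ) * y ^ l = 1 := by
      rw [sum_range_succ']
      simp
    rw [this]; simpa using DD.zero hp _
  | succ k ih =>
    have e : w ^ (k + 1) - ∑ l ∈ range (n + 1), ((k + 1 + l - 1).choose l : ℚ) * y ^ l
      = w * ((w ^ k - ∑ l ∈ range (n + 1), ((k + l - 1).choose l : ℚ) * y ^ l)
        + ((k + n).choose n : ℚ) * y ^ (n + 1)) := by
      have := series_step k n y
      have h2 : ∑ l ∈ range (n + 1), ((k + 1 + l - 1).choose l : ℚ) * y ^ l =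
        w * ((1 - y) * ∑ l ∈ range (n + 1), ((k + 1 + l - 1).choose l : ℚ) * y ^ l) := by
        rw [← mul_assoc, hyw, one_mul]
      rw [h2, this]; ring
    rw [e]
    refine DD.mulr hp hw (ih.add hp (DD.mulr hp ?_ hy))
    exact_mod_cast DD.int hp ((k + n).choose n : ℤ)

/-- the chain condition -/
def CH (star : Bool) {d : ℕ} (m : Fin d → ℕ) : Prop :=
  ∀ i j, i < j → if star then m j ≤ m i else m j < m i

open Classical in
/-- index set -/
noncomputable def IX (star : Bool) (N d : ℕ) : Finset (Fin d → ℕ) :=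
  (Fintype.piFinset (fun _ => Icc 1 N)).filter (CH star)

theorem mem_IX (star : Bool) (N d : ℕ) (m : Fin d → ℕ) :
    m ∈ IX star N d ↔ (∀ i, 1 ≤ m i ∧ m i ≤ N) ∧ CH star m := by
  simp [IX]

theorem MHS_eq (star : Bool) (d N : ℕ) (k : Fin d → ℕ) :
    MHS star N (List.ofFn k) = ∑ m ∈ IX star N d, ∏ i, 1 / (m i : ℚ) ^ k i := by
  induction d generalizing N with
  | zero =>
    have : IX star N 0 = {Fin.elim0} := by
      ext m
      simp [mem_IX, CH]
      exact Subsingleton.elim _ _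
    simp [MHS, this]
  | succ d ih =>
    rw [List.ofFn_succ, MHS]
    simp_rw [ih, mul_sum]
    rw [sum_sigma']
    refine Finset.sum_bij' (fun x _ => Fin.cons x.1 x.2) (fun m _ => ⟨m 0, Fin.tail m⟩) ?_ ?_ ?_ ?_ ?_
    · rintro ⟨i, m⟩ h
      simp only [mem_sigma, mem_Icc, mem_IX] at h
      obtain ⟨⟨h1, h2⟩, h3, h4⟩ := h
      rw [mem_IX]
      constructor
      · intro j
        refine Fin.cases ?_ (fun j => ?_) j
        · simpa using ⟨h1, h2⟩
        · have := h3 j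
          simp only [Fin.cons_succ]
          cases star <;> simp at this <;> omega
      · intro a b
        refine Fin.cases ?_ (fun a => ?_) a <;> refine Fin.cases ?_ (fun b => ?_) b
        · simp
        · intro _
          have := h3 b
          simp only [Fin.cons_succ, Fin.cons_zero]
          cases star <;> simp at this ⊢ <;> omega
        · simp
        · intro hab
          simpa using h4 a b (by simpa using hab)
    · intro m h
      rw [mem_IX] at h
      obtain ⟨h1, h2⟩ := h
      simp only [mem_sigma, mem_Icc, mem_IX]
      refine ⟨h1 0, fun j => ⟨(h1 j.succ).1, ?_⟩, ?_⟩
      · have := h2 0 j.succ (Fin.succ_pos j)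
        simp only [Fin.tail]
        cases star <;> simp at this ⊢ <;> omega
      · intro a b hab
        exact h2 a.succ b.succ (by simpa using hab)
    · rintro ⟨i, m⟩ h
      simp
    · intro m h
      simp
    · rintro ⟨i, m⟩ h
      simp [Fin.prod_univ_succ, mul_comm]

theorem MHS_rev (star : Bool) (p d : ℕ) (k : Fin d → ℕ) :
    MHS star (p - 1) (List.ofFn k).reverse
      = ∑ m ∈ IX star (p - 1) d, ∏ i, 1 / ((p - m i : ℕ) : ℚ) ^ k i := by
  have e : (List.ofFn k).reverse = List.ofFn (fun i => k (Fin.rev i)) := by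
    apply List.ext_getElem
    · simp
    · intro i h1 h2
      simp only [List.getElem_reverse, List.getElem_ofFn, List.length_ofFn]
      congr 1
      ext
      simp [Fin.val_rev]
      omega
  have key : ∀ m ∈ IX star (p - 1) d, (fun i => p - m (Fin.rev i)) ∈ IX star (p - 1) d := by
    intro m h
    rw [mem_IX] at h ⊢
    obtain ⟨h1, h2⟩ := h
    refine ⟨fun i => ?_, fun i j hij => ?_⟩
    · have := h1 (Fin.rev i)
      omega
    · have := h2 (Fin.rev j) (Fin.rev i) (by simpa using hij)
      have a := h1 (Fin.rev j)
      have b := h1 (Fin.rev i)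
      cases star <;> simp at this ⊢ <;> omega
  have inv : ∀ m ∈ IX star (p - 1) d,
      (fun i => p - (fun i => p - m (Fin.rev i)) (Fin.rev i)) = m := by
    intro m h
    rw [mem_IX] at h
    funext i
    have := h.1 i
    simp only [Fin.rev_rev]
    omega
  rw [e, MHS_eq]
  refine Finset.sum_bij' (fun m _ i => p - m (Fin.rev i)) (fun m _ i => p - m (Fin.rev i))
    key key inv inv ?_
  intro m h
  rw [← Equiv.prod_comp Fin.revPerm]
  refine Finset.prod_congr rfl fun i _ => ?_
  rw [mem_IX] at h
  have := h.1 (Fin.rev i)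
  have e : p - (p - m (Fin.rev i)) = m (Fin.rev i) := by omega
  simp [e]

theorem term_mod {p : ℕ} (hp : p.Prime) (n d : ℕ) (k m : Fin d → ℕ)
    (hm : ∀ i, 1 ≤ m i ∧ m i ≤ p - 1) :
    DD p (n + 1) (∏ i, 1 / (m i : ℚ) ^ k i - (-1 : ℚ) ^ (∑ i, k i) *
      ∑ l ∈ Finset.univ.filter (fun l : Fin d → Fin (n + 1) => (∑ i, (l i : ℕ)) < n + 1),
        (p : ℚ) ^ (∑ i, (l i : ℕ)) * ((∏ j, Nat.choose (k j + (l j : ℕ) - 1) (l j) : ℕ) : ℚ) *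
          ∏ i, 1 / ((p - m i : ℕ) : ℚ) ^ (k i + (l i : ℕ))) := by
  set x : Fin d → ℚ := fun i => 1 / ((p - m i : ℕ) : ℚ) with hx
  have hx0 : ∀ i, DD p 0 (x i) := fun i => DD.inv (by have := hm i; omega) (by have := hm i; omega)
  have hp1 := hp.two_le
  have hnat : ∀ q : ℕ, DD p 0 (q : ℚ) := fun q => by exact_mod_cast DD.int hp (q : ℤ)
  -- the term
  set T : (Fin d → Fin (n + 1)) → ℚ := fun l =>
    ∏ i, ((-1) ^ k i * x i ^ k i *
      (((k i + (l i : ℕ) - 1).choose (l i) : ℚ) * ((p : ℚ) * x i) ^ (l i : ℕ))) with hT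
  have hterm : ∀ l : Fin d → Fin (n + 1), (-1 : ℚ) ^ (∑ i, k i) * ((p : ℚ) ^ (∑ i, (l i : ℕ)) *
      ((∏ j, Nat.choose (k j + (l j : ℕ) - 1) (l j) : ℕ) : ℚ) *
          ∏ i, 1 / ((p - m i : ℕ) : ℚ) ^ (k i + (l i : ℕ))) = T l := by
    intro l
    rw [hT]
    simp only [← Finset.prod_pow_eq_pow_sum]
    push_cast
    simp only [← Finset.prod_mul_distrib]
    refine Finset.prod_congr rfl fun i _ => ?_
    rw [hx]
    simp only [mul_pow, div_pow, one_pow, pow_add]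
    ring
  have hTp : ∀ l, DD p (∑ i, (l i : ℕ)) (T l) := by
    intro l
    rw [← hterm l]
    have h1 : DD p 0 ((-1 : ℚ) ^ (∑ i, k i)) := DD.pow hp (by exact_mod_cast DD.int hp (-1)) _
    have h2 : DD p 0 (∏ i, 1 / ((p - m i : ℕ) : ℚ) ^ (k i + (l i : ℕ))) := by
      refine DD.prod hp _ _ fun i _ => ?_
      have := DD.pow hp (hx0 i) (k i + (l i : ℕ))
      simpa [hx] using this
    exact DD.mulr hp h1 (((DD.ppow hp _).mul hp (hnat _)).mul hp h2)
  have hfull : ∏ i, ((-1) ^ k i * x i ^ k i * ∑ l ∈ range (n + 1),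
      ((k i + l - 1).choose l : ℚ) * ((p : ℚ) * x i) ^ l) = ∑ l, T l := by
    simp only [Finset.sum_range, ← mul_sum, hT]
    simp_rw [mul_sum]
    rw [Finset.prod_univ_sum, Fintype.piFinset_univ]
  rw [mul_sum]
  simp only [hterm]
  have hsplit := Finset.sum_filter_add_sum_filter_not Finset.univ
    (fun l : Fin d → Fin (n + 1) => (∑ i, (l i : ℕ)) < n + 1) T
  have hrest : DD p (n + 1) (∑ l ∈ Finset.univ.filter
      (fun l : Fin d → Fin (n + 1) => ¬ (∑ i, (l i : ℕ)) < n + 1), T l) := by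
    refine DD.sum hp _ _ fun l hl => (hTp l).mono ?_
    simpa using hl
  have hmain : DD p (n + 1) (∏ i, 1 / (m i : ℚ) ^ k i - ∑ l, T l) := by
    rw [← hfull]
    have hs : ∀ i, DD p 0 ((-1) ^ k i * x i ^ k i) := fun i =>
      DD.mulr hp (DD.pow hp (by exact_mod_cast DD.int hp (-1)) _) (DD.pow hp (hx0 i) _)
    have hpx : ∀ i l, DD p l (((p : ℚ) * x i) ^ l) := fun i l => by
      rw [mul_pow]; simpa using (DD.ppow hp l).mul hp (DD.pow hp (hx0 i) l)
    refine DD.prod_sub hp _ _ _ (fun i _ => ?_) (fun i _ => ?_) (fun i _ => ?_)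
    · have := DD.pow hp (DD.inv (p := p) (i := m i) (hm i).1 (by have := hm i; omega)) (k i)
      simpa using this
    · refine DD.mulr hp (hs i) (DD.sum hp _ _ fun l _ => DD.mulr hp (hnat _) ((hpx i l).mono (by omega)))
    · have hmi := hm i
      have hc : ((p - m i : ℕ) : ℚ) = p - m i := by
        rw [Nat.cast_sub (by omega)]
      have hne : ((p : ℚ) - m i) ≠ 0 := by
        rw [← hc]; exact_mod_cast (by omega : p - m i ≠ 0)
      have hne2 : (m i : ℚ) ≠ 0 := by exact_mod_cast (by omega : m i ≠ 0)
      set w : ℚ := -((p - m i : ℕ) : ℚ) * (1 / (m i : ℚ)) with hw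
      have hxw : -1 * x i * w = 1 / (m i : ℚ) := by
        rw [hw, hx]; simp only [hc]; field_simp
      have := series_mod hp n (k i) (p * x i) w (hpx i _)
        (DD.mulr hp ((hnat _).neg hp) (DD.inv (hm i).1 (by omega)))
        (by rw [hw, hx]; simp only [hc]; field_simp; ring)
      have h2 := DD.mulr hp (hs i) this
      rw [mul_sub] at h2
      rw [← mul_pow, ← mul_pow, hxw, mul_pow] at h2
      simpa using h2
  have := hmain.add hp hrest
  rw [← hsplit] at this
  convert this using 1
  ring

/-- Reversal formula for multiple harmonic sums modulo `p^n` (Corollary 5.3 of the paper for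
`𝒜̂`):  `H•_{p−1}(k) − (−1)^{wt(k)} Σ_{wt(l) < n} p^{wt(l)} b(k;l) H•_{p−1}(rev(k+l)) ∈ p^n ℤ_{(p)}`
for both `• = ∅` and `• = ⋆`. -/
theorem stmt2 (p : ℕ) (hp : p.Prime) (n : ℕ) (hn : 1 ≤ n)
    (d : ℕ) (k : Fin d → ℕ) (hk : ∀ i, 1 ≤ k i) (star : Bool) :
    ∃ a b : ℤ, ¬ ((p : ℤ) ∣ b) ∧
      (MHS star (p - 1) (List.ofFn k) -
        (-1 : ℚ) ^ (∑ i, k i) *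
          ∑ l ∈ Finset.univ.filter (fun l : Fin d → Fin n => (∑ i, (l i : ℕ)) < n),
            (p : ℚ) ^ (∑ i, (l i : ℕ)) *
              ((∏ j, Nat.choose (k j + (l j : ℕ) - 1) (l j) : ℕ) : ℚ) *
              MHS star (p - 1) (List.ofFn (fun i => k i + (l i : ℕ))).reverse) * b
        = p ^ n * a := by
  obtain ⟨n, rfl⟩ : ∃ n', n = n' + 1 := ⟨n - 1, by omega⟩
  change DD p (n + 1) _
  simp_rw [MHS_rev, MHS_eq]
  have e := DD.sum hp (IX star (p - 1) d) _ fun m hm =>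
    term_mod hp n d k m ((mem_IX _ _ _ _).mp hm).1
  convert e using 1
  rw [Finset.sum_sub_distrib, ← mul_sum, Finset.sum_comm]
  simp_rw [mul_sum]
end

section
/- Let p be a prime, and let m, k, n be integers with p > m ≥ 1, k ≥ 1, n ≥ 1. Then in ℚ(q): 1/[p−m]^k ≡ (−q^{−p} · q^m/[m])^k · Σ_{l=0}^{n−1} binom(k + l − 1, l) · (q^{−p} [p] · q^m/[m])^l (mod [p]^n). -/
open Finset

/-- `[N] = 1 + q + ⋯ + q^{N-1}` in `ℚ[q]`. -/
noncomputable def qiP (N : ℕ) : Polynomial ℚ := ∑ i ∈ Finset.range N, Polynomial.X ^ i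

/-- `[N] = 1 + q + ⋯ + q^{N-1}` in `ℚ(q)`. -/
noncomputable def qiR (N : ℕ) : RatFunc ℚ := ∑ i ∈ Finset.range N, RatFunc.X ^ i

/-- `A ≡ B (mod [p]^n)` in `ℚ(q)`:  `A − B = [p]^n f/g` with `f, g ∈ ℚ[q]`, `[p] ∤ g`. -/
def CongMod (p n : ℕ) (A B : RatFunc ℚ) : Prop :=
  ∃ f g : Polynomial ℚ, ¬ (qiP p ∣ g) ∧
    A - B = (algebraMap (Polynomial ℚ) (RatFunc ℚ) (qiP p)) ^ n *
      (algebraMap (Polynomial ℚ) (RatFunc ℚ) f / algebraMap (Polynomial ℚ) (RatFunc ℚ) g)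


lemma aux_sum {R : Type*} [CommRing R] (x : R) (k n : ℕ) :
    (1 - x) * ∑ l ∈ Finset.range (n + 1), ((k + 1 + l - 1).choose l : R) * x ^ l
      = ∑ l ∈ Finset.range (n + 1), ((k + l - 1).choose l : R) * x ^ l
        - ((k + n).choose n : R) * x ^ (n + 1) := by
  induction n with
  | zero => simp
  | succ n ih =>
    rw [Finset.sum_range_succ, mul_add, ih, Finset.sum_range_succ _ (n + 1)]
    have h1 : k + 1 + (n + 1) - 1 = (k + n) + 1 := by omega
    have h2 : k + (n + 1) - 1 = k + n := by omega
    have h3 : k + (n + 1) = (k + n) + 1 := by omega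
    rw [h1, h2, h3, Nat.choose_succ_succ]
    push_cast
    ring

lemma aux_rem {R : Type*} [CommRing R] (x : R) (k n : ℕ) :
    ∃ y : R, 1 - (1 - x) ^ k *
      ∑ l ∈ Finset.range (n + 1), ((k + l - 1).choose l : R) * x ^ l = x ^ (n + 1) * y := by
  induction k with
  | zero =>
    refine ⟨0, ?_⟩
    rw [Finset.sum_range_succ']
    have : ∀ l ∈ Finset.range n, ((0 + (l + 1) - 1).choose (l + 1) : R) * x ^ (l + 1) = 0 := by
      intro l _
      have h : 0 + (l + 1) - 1 = l := by omega
      rw [h, Nat.choose_succ_self]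
      simp
    rw [Finset.sum_eq_zero this]
    simp
  | succ k ih =>
    obtain ⟨y, hy⟩ := ih
    refine ⟨y + ((k + n).choose n : R) * (1 - x) ^ k, ?_⟩
    rw [pow_succ, mul_assoc, aux_sum, mul_add, ← hy]
    ring

/-- The localization of `ℚ[q]` at a prime `P`, inside `ℚ(q)`. -/
def locSub (P : Polynomial ℚ) (hP : Prime P) : Subring (RatFunc ℚ) where
  carrier := {A | ∃ f g : Polynomial ℚ, ¬ (P ∣ g) ∧
    A = algebraMap (Polynomial ℚ) (RatFunc ℚ) f / algebraMap (Polynomial ℚ) (RatFunc ℚ) g}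
  mul_mem' := by
    rintro a b ⟨f, g, hg, rfl⟩ ⟨f', g', hg', rfl⟩
    refine ⟨f * f', g * g', fun h => (hP.dvd_or_dvd h).elim hg hg', ?_⟩
    rw [map_mul, map_mul, div_mul_div_comm]
  one_mem' := ⟨1, 1, hP.not_dvd_one, by simp⟩
  add_mem' := by
    rintro a b ⟨f, g, hg, rfl⟩ ⟨f', g', hg', rfl⟩
    refine ⟨f * g' + g * f', g * g', fun h => (hP.dvd_or_dvd h).elim hg hg', ?_⟩
    have h0 : algebraMap (Polynomial ℚ) (RatFunc ℚ) g ≠ 0 :=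
      RatFunc.algebraMap_ne_zero (by rintro rfl; exact hg (dvd_zero _))
    have h0' : algebraMap (Polynomial ℚ) (RatFunc ℚ) g' ≠ 0 :=
      RatFunc.algebraMap_ne_zero (by rintro rfl; exact hg' (dvd_zero _))
    rw [div_add_div _ _ h0 h0']
    simp
  zero_mem' := ⟨0, 1, hP.not_dvd_one, by simp⟩
  neg_mem' := by
    rintro a ⟨f, g, hg, rfl⟩
    exact ⟨-f, g, hg, by simp [neg_div]⟩

lemma qiR_eq (N : ℕ) : qiR N = algebraMap (Polynomial ℚ) (RatFunc ℚ) (qiP N) := by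
  simp [qiR, qiP]

lemma qiP_mul (N : ℕ) : qiP N * (Polynomial.X - 1) = Polynomial.X ^ N - 1 :=
  geom_sum_mul _ _

lemma qiP_prime {p : ℕ} (hp : p.Prime) : Prime (qiP p) := by
  haveI := Fact.mk hp
  have : qiP p = Polynomial.cyclotomic p ℚ := (Polynomial.cyclotomic_prime ℚ p).symm
  rw [this]
  exact (Polynomial.cyclotomic.irreducible_rat hp.pos).prime

lemma qiP_ne_zero {N : ℕ} (h : 1 ≤ N) : qiP N ≠ 0 := by
  intro h0
  have := qiP_mul N
  rw [h0, zero_mul] at this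
  exact (Polynomial.X_pow_sub_C_ne_zero (R := ℚ) h 1) (by simpa using this.symm)

lemma qiP_natDegree {N : ℕ} (h : 1 ≤ N) : (qiP N).natDegree + 1 = N := by
  have h1 := congrArg Polynomial.natDegree (qiP_mul N)
  have hX : (Polynomial.X - 1 : Polynomial ℚ) = Polynomial.X - Polynomial.C 1 := by simp
  have hX' : (Polynomial.X ^ N - 1 : Polynomial ℚ) = Polynomial.X ^ N - Polynomial.C 1 := by simp
  rw [hX, hX', Polynomial.natDegree_mul (qiP_ne_zero h) (Polynomial.X_sub_C_ne_zero _),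
    Polynomial.natDegree_X_sub_C, Polynomial.natDegree_X_pow_sub_C] at h1
  exact h1

lemma qiP_not_dvd {p N : ℕ} (h : 1 ≤ N) (hN : N < p) : ¬ (qiP p ∣ qiP N) := by
  intro hd
  have := Polynomial.natDegree_le_of_dvd hd (qiP_ne_zero h)
  have h1 := qiP_natDegree h
  have h2 := qiP_natDegree (N := p) (by omega)
  omega

lemma qiP_not_dvd_X {p : ℕ} (hp : p.Prime) : ¬ (qiP p ∣ Polynomial.X) := by
  intro hd
  have h1 : qiP p ∣ Polynomial.X ^ p - 1 := ⟨_, (qiP_mul p).symm⟩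
  have h2 : qiP p ∣ Polynomial.X ^ p := hd.trans (dvd_pow_self _ hp.ne_zero)
  have h3 := dvd_sub h2 h1
  exact (qiP_prime hp).not_dvd_one (by simpa using h3)

/-- Lemma B.1 of the paper:
`1/[p−m]^k ≡ (−q^{−p} q^m/[m])^k Σ_{l=0}^{n−1} C(k+l−1, l) (q^{−p}[p] q^m/[m])^l (mod [p]^n)`. -/
theorem stmt3 (p : ℕ) (hp : p.Prime) (m k n : ℕ)
    (hm : 1 ≤ m) (hmp : m < p) (hk : 1 ≤ k) (hn : 1 ≤ n) :
    CongMod p n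
      (1 / (qiR (p - m)) ^ k)
      ((-(RatFunc.X ^ p)⁻¹ * (RatFunc.X ^ m / qiR m)) ^ k *
        ∑ l ∈ Finset.range n, ((k + l - 1).choose l : RatFunc ℚ) *
          ((RatFunc.X ^ p)⁻¹ * qiR p * (RatFunc.X ^ m / qiR m)) ^ l) := by
  obtain ⟨n, rfl⟩ : ∃ n', n = n' + 1 := ⟨n - 1, by omega⟩
  have hP := qiP_prime hp
  have ha0 : qiR m ≠ 0 := by
    rw [qiR_eq]; exact RatFunc.algebraMap_ne_zero (qiP_ne_zero hm)
  have hr0 : qiR (p - m) ≠ 0 := by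
    rw [qiR_eq]; exact RatFunc.algebraMap_ne_zero (qiP_ne_zero (by omega))
  have hq0 : (RatFunc.X : RatFunc ℚ) ≠ 0 := RatFunc.X_ne_zero
  have hqp : (RatFunc.X : RatFunc ℚ) ^ p ≠ 0 := pow_ne_zero _ hq0
  have hqm : (RatFunc.X : RatFunc ℚ) ^ m ≠ 0 := pow_ne_zero _ hq0
  have hadd : RatFunc.X ^ m * qiR p = RatFunc.X ^ m * qiR (p - m) + RatFunc.X ^ p * qiR m := by
    have h1 : qiR p = qiR (p - m) + RatFunc.X ^ (p - m) * qiR m := by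
      conv_lhs => rw [show p = (p - m) + m by omega]
      unfold qiR
      rw [Finset.sum_range_add, Finset.mul_sum]
      simp only [pow_add]
    have h2 : (RatFunc.X : RatFunc ℚ) ^ p = RatFunc.X ^ m * RatFunc.X ^ (p - m) := by
      rw [← pow_add]; congr 1; omega
    rw [h1, h2]; ring
  -- the unit `u = q^m / (q^p [m])` of the local ring
  set u : RatFunc ℚ := (RatFunc.X ^ p)⁻¹ * (RatFunc.X ^ m / qiR m) with hu
  have hone : 1 - qiR p * u = -u * qiR (p - m) := by
    rw [hu]
    field_simp
    linear_combination -hadd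
  have hu0 : u ≠ 0 := mul_ne_zero (inv_ne_zero hqp) (div_ne_zero hqm ha0)
  have huS : u ∈ locSub (qiP p) hP := by
    refine ⟨Polynomial.X ^ m, Polynomial.X ^ p * qiP m, ?_, ?_⟩
    · intro h
      rcases hP.dvd_or_dvd h with h | h
      · exact qiP_not_dvd_X hp (hP.dvd_of_dvd_pow h)
      · exact qiP_not_dvd hm hmp h
    · rw [hu, qiR_eq, map_mul, map_pow, map_pow, RatFunc.algebraMap_X]
      field_simp
  have hPS : qiR p ∈ locSub (qiP p) hP := ⟨qiP p, 1, hP.not_dvd_one, by simp [qiR_eq]⟩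
  have hrS : (qiR (p - m))⁻¹ ∈ locSub (qiP p) hP :=
    ⟨1, qiP (p - m), qiP_not_dvd (by omega) (by omega), by simp [qiR_eq]⟩
  obtain ⟨y, hy⟩ := aux_rem (⟨qiR p * u, mul_mem hPS huS⟩ : locSub (qiP p) hP) k n
  have hy' := congrArg (Subtype.val) hy
  push_cast at hy'
  obtain ⟨f, g, hg, hfg⟩ := mul_mem (mul_mem (pow_mem hrS k) (pow_mem huS (n + 1))) y.2
  refine ⟨f, g, hg, ?_⟩
  rw [← hfg, ← qiR_eq]
  have e1 : -(RatFunc.X ^ p)⁻¹ * (RatFunc.X ^ m / qiR m) = -u := by rw [hu]; ring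
  have e2 : (RatFunc.X ^ p)⁻¹ * qiR p * (RatFunc.X ^ m / qiR m) = qiR p * u := by rw [hu]; ring
  rw [e1, e2]
  have e3 : (-u) ^ k = ((qiR (p - m))⁻¹) ^ k * (1 - qiR p * u) ^ k := by
    rw [hone, ← mul_pow]; congr 1; field_simp
  rw [e3, one_div, ← inv_pow, mul_assoc]
  have e4 := congrArg (fun z => (qiR (p - m))⁻¹ ^ k * z) hy'
  simp only [mul_sub, mul_one] at e4
  rw [mul_pow (qiR p) u (n + 1)] at e4
  rw [e4]
  ring
end

section
/- Let d ≥ 1, and let s = (s_1, …, s_d) ∈ ℤ_{≥0}^d and k = (k_1, …, k_d) ∈ ℤ_{≥1}^d satisfy 0 ≤ s_a ≤ k_a − 1 for all a, with s ≠ (0, …, 0). For an integer m ≥ 2, set ζ_m = e^{2πi/m}, A_m^−(s; k) = Σ_{m/2 > m_1 > ⋯ > m_d > 0} Π_{a=1}^{d} (m_a/m)^{s_a} · (−2πi/m)^{k_a} · ζ_m^{(k_a−1) m_a} / (1 − ζ_m^{m_a})^{k_a}, and A_m^+(s; k) the same sum with the range m/2 ≥ m_1 > ⋯ > m_d > 0.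 Then there exists a constant C > 0 such that |A_m^−(s; k)| ≤ C · (log m)^d / m and |A_m^+(s; k)| ≤ C · (log m)^d / m for all integers m ≥ 2. -/
open Finset

/-- The nested sum
`A m M L = Σ_{M ≥ m₁ > m₂ > ⋯ > m_d ≥ 1} Π_{a} (m_a/m)^{s_a} (−2πi/m)^{k_a}
ζ_m^{(k_a−1)m_a} / (1 − ζ_m^{m_a})^{k_a}`
where `L = [(s₁,k₁), …, (s_d,k_d)]` and `ζ_m = e^{2πi/m}`.  With `M = (m−1)/2` (resp. `M = m/2`,
natural division) this is `A_m^−(s;k)` (range `m/2 > m₁ > ⋯`) resp. `A_m^+(s;k)`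
(range `m/2 ≥ m₁ > ⋯`). -/
noncomputable def Asum (m : ℕ) : ℕ → List (ℕ × ℕ) → ℂ
  | _, [] => 1
  | M, (s, k) :: rest => ∑ i ∈ Finset.Icc 1 M,
      ((i : ℂ) / (m : ℂ)) ^ s * (-(2 * Real.pi * Complex.I) / (m : ℂ)) ^ k *
        Complex.exp (2 * Real.pi * Complex.I / m) ^ ((k - 1) * i) /
        (1 - Complex.exp (2 * Real.pi * Complex.I / m) ^ i) ^ k *
        Asum m (i - 1) rest

lemma aux_denom (m i : ℕ) (hi : 1 ≤ i) (him : 2 * i ≤ m) :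
    4 * (i : ℝ) / m ≤ ‖1 - Complex.exp (2 * Real.pi * Complex.I / m) ^ i‖ := by
  have hm : (0 : ℝ) < m := by
    have : 0 < m := by omega
    exact_mod_cast this
  have h1 : Complex.exp (2 * Real.pi * Complex.I / m) ^ i
      = Complex.exp (Complex.I * ((2 * Real.pi * i / m : ℝ) : ℂ)) := by
    rw [← Complex.exp_nat_mul]
    congr 1
    push_cast
    ring
  rw [h1, norm_sub_rev, Complex.norm_exp_I_mul_ofReal_sub_one]
  have h2 : 2 * Real.pi * i / m / 2 = Real.pi * i / m := by ring
  rw [h2]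
  have hi2 : (2 * (i : ℝ)) ≤ m := by exact_mod_cast him
  have h3 : 2 / Real.pi * (Real.pi * i / m) ≤ Real.sin (Real.pi * i / m) := by
    apply Real.mul_le_sin
    · positivity
    · rw [div_le_div_iff₀ hm (by norm_num)]
      nlinarith [Real.pi_pos]
  have h4 : 2 / Real.pi * (Real.pi * i / m) = 2 * i / m := by
    field_simp
  rw [h4] at h3
  rw [Real.norm_eq_abs]
  refine le_trans ?_ (le_abs_self _)
  calc 4 * (i : ℝ) / m = 2 * (2 * i / m) := by ring
    _ ≤ _ := by linarith

noncomputable def auxW (m : ℕ) (p : ℕ × ℕ) : ℝ :=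
  (Real.pi / 2) ^ p.2 * (if p.1 = 0 then 1 else 1 / (m : ℝ))

lemma auxW_nonneg (m : ℕ) (p : ℕ × ℕ) : 0 ≤ auxW m p := by
  unfold auxW
  split_ifs <;> positivity

lemma aux_term (m i s k : ℕ) (hi : 1 ≤ i) (him : 2 * i ≤ m) (hk : 1 ≤ k) (hs : s ≤ k - 1) :
    ‖((i : ℂ) / (m : ℂ)) ^ s * (-(2 * Real.pi * Complex.I) / (m : ℂ)) ^ k *
        Complex.exp (2 * Real.pi * Complex.I / m) ^ ((k - 1) * i) /
        (1 - Complex.exp (2 * Real.pi * Complex.I / m) ^ i) ^ k‖ ≤ auxW m (s, k) * (1 / i) := by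
  have hm0 : 0 < m := by omega
  have hm : (1 : ℝ) ≤ m := by exact_mod_cast hm0
  have hi1 : (1 : ℝ) ≤ i := by exact_mod_cast hi
  have hd := aux_denom m i hi him
  have he : ‖Complex.exp (2 * Real.pi * Complex.I / m)‖ = 1 := by
    have : (2 * Real.pi * Complex.I / m : ℂ) = ((2 * Real.pi / m : ℝ) : ℂ) * Complex.I := by
      push_cast; ring
    rw [this, Complex.norm_exp_ofReal_mul_I]
  have hn : ‖-(2 * Real.pi * Complex.I) / (m : ℂ)‖ = 2 * Real.pi / m := by
    simp [abs_of_pos Real.pi_pos]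
  rw [norm_div, norm_mul, norm_mul, norm_pow, norm_pow, norm_pow, norm_pow, he, hn, one_pow,
    mul_one, norm_div, Complex.norm_natCast, Complex.norm_natCast]
  have hpos : (0 : ℝ) < 4 * i / m := by positivity
  calc ((i : ℝ) / m) ^ s * (2 * Real.pi / m) ^ k /
        ‖1 - Complex.exp (2 * Real.pi * Complex.I / m) ^ i‖ ^ k
      ≤ ((i : ℝ) / m) ^ s * (2 * Real.pi / m) ^ k / (4 * i / m) ^ k := by gcongr
    _ = (Real.pi / 2) ^ k * (((i : ℝ) / m) ^ s * (1 / (i : ℝ)) ^ k) := by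
        rw [mul_div_assoc, ← div_pow]
        have : 2 * Real.pi / m / (4 * i / m) = Real.pi / 2 * (1 / (i : ℝ)) := by
          field_simp; norm_num
        rw [this, mul_pow]; ring
    _ ≤ (Real.pi / 2) ^ k * ((if s = 0 then 1 else 1 / (m : ℝ)) * (1 / i)) := by
        apply mul_le_mul_of_nonneg_left _ (by positivity)
        obtain ⟨t, rfl⟩ : ∃ t, k = s + 1 + t := ⟨k - (s + 1), by omega⟩
        have e1 : ((i : ℝ) / m) ^ s * (1 / (i : ℝ)) ^ (s + 1 + t)
            = (1 / (m : ℝ)) ^ s * (1 / i) * (1 / i) ^ t := by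
          rw [pow_add, pow_add, pow_one, ← mul_assoc, ← mul_assoc, ← mul_pow]
          congr 3
          field_simp
        rw [e1]
        have h1 : (1 / (i : ℝ)) ^ t ≤ 1 :=
          pow_le_one₀ (by positivity) (by rw [div_le_one (by linarith)]; exact hi1)
        have hmm : 1 / (m : ℝ) ≤ 1 := by rw [div_le_one (by linarith)]; exact hm
        have h2 : (1 / (m : ℝ)) ^ s ≤ (if s = 0 then 1 else 1 / (m : ℝ)) := by
          split_ifs with h
          · simp [h]
          · exact pow_le_of_le_one (by positivity) hmm h
        calc (1 / (m : ℝ)) ^ s * (1 / i) * (1 / i) ^ t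
            ≤ (1 / (m : ℝ)) ^ s * (1 / i) * 1 := by gcongr
          _ ≤ _ := by rw [mul_one]; gcongr
    _ = _ := by simp only [auxW]; ring

lemma aux_main (m : ℕ) (L : List (ℕ × ℕ)) (hL : ∀ p ∈ L, 1 ≤ p.2 ∧ p.1 ≤ p.2 - 1) :
    ∀ M, 2 * M ≤ m → ‖Asum m M L‖ ≤
      (L.map (auxW m)).prod * (∑ i ∈ Finset.Icc 1 (m / 2), 1 / (i : ℝ)) ^ L.length := by
  induction L with
  | nil => intro M _; simp [Asum]
  | cons p rest ih =>
    obtain ⟨s, k⟩ := p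
    intro M hM
    have ih' := ih (fun p hp => hL p (List.mem_cons_of_mem _ hp))
    obtain ⟨hk, hs⟩ := hL (s, k) List.mem_cons_self
    set H := ∑ i ∈ Finset.Icc 1 (m / 2), 1 / (i : ℝ) with hH
    have hH0 : 0 ≤ H := Finset.sum_nonneg (fun i _ => by positivity)
    have hP : 0 ≤ (rest.map (auxW m)).prod := by
      apply List.prod_nonneg
      intro a ha
      obtain ⟨q, _, rfl⟩ := List.mem_map.1 ha
      exact auxW_nonneg m q
    have hw := auxW_nonneg m (s, k)
    rw [Asum, List.map_cons, List.prod_cons, List.length_cons]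
    refine (norm_sum_le _ _).trans ?_
    calc _ ≤ ∑ i ∈ Finset.Icc 1 M, auxW m (s, k) * (1 / (i : ℝ)) *
            ((rest.map (auxW m)).prod * H ^ rest.length) := by
          apply Finset.sum_le_sum
          intro i hi
          rw [Finset.mem_Icc] at hi
          rw [norm_mul]
          exact mul_le_mul (aux_term m i s k hi.1 (by omega) hk hs) (ih' _ (by omega))
            (norm_nonneg _) (by positivity)
      _ = auxW m (s, k) * (∑ i ∈ Finset.Icc 1 M, 1 / (i : ℝ)) *
            ((rest.map (auxW m)).prod * H ^ rest.length) := by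
          rw [Finset.mul_sum, Finset.sum_mul]
      _ ≤ auxW m (s, k) * H * ((rest.map (auxW m)).prod * H ^ rest.length) := by
          gcongr
          apply Finset.sum_le_sum_of_subset_of_nonneg
          · exact Finset.Icc_subset_Icc_right (by omega)
          · intros; positivity
      _ = _ := by ring

lemma aux_harm (m : ℕ) (hm : 2 ≤ m) :
    ∑ i ∈ Finset.Icc 1 (m / 2), 1 / (i : ℝ) ≤ 3 * Real.log m := by
  have h1 := harmonic_le_one_add_log (m / 2)
  rw [harmonic_eq_sum_Icc] at h1
  push_cast at h1
  have h2 : Real.log ((m / 2 : ℕ) : ℝ) ≤ Real.log m := by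
    apply Real.log_le_log
    · have : 0 < m / 2 := by omega
      exact_mod_cast this
    · exact_mod_cast Nat.div_le_self _ _
  have h3 : Real.log 2 ≤ Real.log m := Real.log_le_log (by norm_num) (by exact_mod_cast hm)
  have := Real.log_two_gt_d9
  simp only [one_div]
  linarith

/-- Lemma A.8 of the paper (the case `s ≠ 0`):  if `0 ≤ s_a ≤ k_a − 1` for all `a` and
`s ≠ (0,…,0)`, then `A_m^±(s; k) = O((log m)^d / m)`. -/
theorem stmt15 (d : ℕ) (hd : 1 ≤ d) (s : Fin d → ℕ) (k : Fin d → ℕ)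
    (hk : ∀ i, 1 ≤ k i) (hs : ∀ i, s i ≤ k i - 1) (hs0 : s ≠ 0) :
    ∃ C : ℝ, 0 < C ∧ ∀ m : ℕ, 2 ≤ m →
      ‖Asum m ((m - 1) / 2) (List.ofFn (fun i => (s i, k i)))‖ ≤
          C * (Real.log m) ^ d / m ∧
        ‖Asum m (m / 2) (List.ofFn (fun i => (s i, k i)))‖ ≤
          C * (Real.log m) ^ d / m := by
  refine ⟨(∏ i, (Real.pi / 2) ^ k i) * 3 ^ d, by
    have := Real.pi_pos
    positivity, fun m hm => ?_⟩
  have hm1 : (1 : ℝ) ≤ m := by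
    have : 1 ≤ m := by omega
    exact_mod_cast this
  obtain ⟨j, hj⟩ := Function.ne_iff.1 hs0
  have key : ∀ M, 2 * M ≤ m → ‖Asum m M (List.ofFn (fun i => (s i, k i)))‖ ≤
      (∏ i, (Real.pi / 2) ^ k i) * 3 ^ d * (Real.log m) ^ d / m := by
    intro M hM
    refine (aux_main m _ ?_ M hM).trans ?_
    · intro p hp
      obtain ⟨i, rfl⟩ := (List.mem_ofFn' _ _).1 hp
      exact ⟨hk i, hs i⟩
    · rw [List.map_ofFn, List.prod_ofFn, List.length_ofFn]
      have e : ∏ i, (auxW m ∘ fun i => (s i, k i)) i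
          ≤ (∏ i, (Real.pi / 2) ^ k i) * (1 / m) := by
        simp only [Function.comp, auxW]
        rw [Finset.prod_mul_distrib]
        have hmm : 1 / (m : ℝ) ≤ 1 := by rw [div_le_one (by linarith)]; exact hm1
        gcongr
        rw [← Finset.mul_prod_erase _ _ (Finset.mem_univ j)]
        have hj' : s j ≠ 0 := hj
        rw [if_neg hj']
        apply mul_le_of_le_one_right (by positivity)
        apply Finset.prod_le_one
        · intro i _; split_ifs <;> positivity
        · intro i _; split_ifs
          · exact le_rfl
          · exact hmm
      calc _ ≤ ((∏ i, (Real.pi / 2) ^ k i) * (1 / m)) * (3 * Real.log m) ^ d := by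
            apply mul_le_mul e _ (by positivity) (by positivity)
            exact pow_le_pow_left₀ (Finset.sum_nonneg (fun i _ => by positivity))
              (aux_harm m hm) d
        _ = _ := by rw [mul_pow]; ring
  exact ⟨key _ (by omega), key _ (by omega)⟩
end
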